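/- Let n, k, m be positive integers with k ≤ n, let S, T ⊆ {1,…,n} with |S| = |T| = k and |S ∩ T| = βk for some real β with 0 ≤ β ≤ 0.9, and let d > 0 with δ := d/√k < 1. Let v_1, …, v_m be independent random vectors in ℝ^n with i.i.d. standard Gaussian N(0,1) entries, and for a subset U of size k let F_U denote the event that |Σ_{i∈U} (v_j)_i| > d for every j ∈ {1,…,m}. Then P[F_S ∩ F_T] ≤ (1 − 2(√(2/π)·δ − δ³/√(2π)) + (2/π)·δ²/(1 − β))^m. -/

import Mathlib

open MeasureTheory ProbabilityTheory
open scoped NNReal ENNReal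

/-- The sign function: `1` if `0 ≤ z`, `-1` otherwise. -/
noncomputable def sgn (z : ℝ) : ℝ := if 0 ≤ z then 1 else -1

/-- `X_k(R)`: vectors in `ℝ^n` with at most `k` nonzero entries whose nonzero
entries have magnitude ratio at most `R`. -/
def sparseDR (n k : ℕ) (R : ℝ) : Set (Fin n → ℝ) :=
  {x | (Finset.univ.filter fun i => x i ≠ 0).card ≤ k ∧
       ∀ i j : Fin n, x i ≠ 0 → x j ≠ 0 → |x i| ≤ R * |x j|}

/-- `A` is a valid universal 1-bit measurement matrix for support recovery on `X_k(R)`. -/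
def ValidMeas (m n k : ℕ) (R : ℝ) (A : Fin m → Fin n → ℝ) : Prop :=
  ∀ u ∈ sparseDR n k R, ∀ v ∈ sparseDR n k R,
    Function.support u ≠ Function.support v →
      (fun i => sgn (∑ j, A i j * u j)) ≠ (fun i => sgn (∑ j, A i j * v j))

/-- `V ⊆ ℝ^n` is `(n, ℓ, d)`-balanced. -/
def IsBalanced (n ℓ : ℕ) (d : ℝ) (V : Set (Fin n → ℝ)) : Prop :=
  ∀ S : Finset (Fin n), S.card = ℓ → ∃ v ∈ V, |∑ i ∈ S, v i| ≤ d

/-- Law of a random vector in `ℝ^n` with i.i.d. standard Gaussian entries. -/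
noncomputable def gaussVec (n : ℕ) : Measure (Fin n → ℝ) :=
  Measure.pi fun _ => gaussianReal 0 1

/-- Law of `m` independent random vectors in `ℝ^n` with i.i.d. standard Gaussian entries
(equivalently, an `m × n` random matrix with i.i.d. `N(0,1)` entries). -/
noncomputable def gaussMat (m n : ℕ) : Measure (Fin m → Fin n → ℝ) :=
  Measure.pi fun _ => gaussVec n

/-- The event `F_U`: every one of the `m` vectors `v j` satisfies `|∑_{i ∈ U} (v j) i| > d`. -/
def FEvent (m n : ℕ) (d : ℝ) (U : Finset (Fin n)) : Set (Fin m → Fin n → ℝ) :=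
  {v | ∀ j : Fin m, d < |∑ i ∈ U, v j i|}

/-- A nondegenerate real Gaussian charges a ball of radius `d` with at most `2d` times the maximum
of its density. -/
lemma gaussianReal_closedBall_le (μ : ℝ) {v : ℝ≥0} (hv : v ≠ 0) (a d : ℝ) :
    gaussianReal μ v (Metric.closedBall a d) ≤
      ENNReal.ofReal ((√(2 * Real.pi * v))⁻¹ * (2 * d)) := by
  rw [gaussianReal_apply μ hv]
  calc ∫⁻ x in Metric.closedBall a d, gaussianPDF μ v x
      ≤ ∫⁻ _ in Metric.closedBall a d, ENNReal.ofReal (√(2 * Real.pi * v))⁻¹ := by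
        refine lintegral_mono fun x => ENNReal.ofReal_le_ofReal ?_
        refine mul_le_of_le_one_right (by positivity) (Real.exp_le_one_iff.2 ?_)
        exact div_nonpos_of_nonpos_of_nonneg (neg_nonpos.2 (sq_nonneg _)) (by positivity)
    _ = _ := by
        rw [setLIntegral_const, Real.volume_closedBall, ← ENNReal.ofReal_mul (by positivity)]

/-- Lower bound for the mass a centred real Gaussian gives to a centred ball, from
`1 - t ≤ exp (-t)` applied to the density. -/
lemma le_gaussianReal_zero_closedBall {v : ℝ≥0} (hv : v ≠ 0) {d : ℝ} (hd : 0 ≤ d) :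
    ENNReal.ofReal ((√(2 * Real.pi * v))⁻¹ * (1 - d ^ 2 / (2 * v)) * (2 * d)) ≤
      gaussianReal 0 v (Metric.closedBall 0 d) := by
  rw [gaussianReal_apply 0 hv]
  calc _ = ∫⁻ _ in Metric.closedBall (0 : ℝ) d,
        ENNReal.ofReal ((√(2 * Real.pi * v))⁻¹ * (1 - d ^ 2 / (2 * v))) := by
        rw [setLIntegral_const, Real.volume_closedBall, ← ENNReal.ofReal_mul' (by positivity)]
    _ ≤ ∫⁻ x in Metric.closedBall 0 d, gaussianPDF 0 v x := by
        refine setLIntegral_mono' Metric.isClosed_closedBall.measurableSet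
          fun x hx => ENNReal.ofReal_le_ofReal ?_
        rw [mem_closedBall_zero_iff, Real.norm_eq_abs] at hx
        refine mul_le_mul_of_nonneg_left ?_ (by positivity)
        have hxd : x ^ 2 / (2 * (v : ℝ)) ≤ d ^ 2 / (2 * v) := by
          gcongr ?_ / _
          exact sq_le_sq.2 (hx.trans (le_abs_self d))
        have hexp := Real.add_one_le_exp (-(x - 0) ^ 2 / (2 * (v : ℝ)))
        rw [sub_zero, neg_div] at hexp ⊢
        linarith

/-- If `B` is independent of `W` and its law gives mass at most `c` to every ball of radius `d`,
then so does, conditionally on `W ∈ G`, any translate of `B` by a function of `W`. -/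
lemma ProbabilityTheory.IndepFun.measure_abs_add_le_inter_le {Ω γ : Type*} [MeasurableSpace Ω]
    [MeasurableSpace γ] {μ : Measure Ω} [IsProbabilityMeasure μ] {B : Ω → ℝ} {W : Ω → γ}
    (hBW : IndepFun B W μ) (hB : Measurable B) (hW : Measurable W) {f : γ → ℝ}
    (hf : Measurable f) {G : Set γ} (hG : MeasurableSet G) {d : ℝ} {c : ℝ≥0∞}
    (hc : ∀ a, μ.map B (Metric.closedBall a d) ≤ c) :
    μ ({ω | |B ω + f (W ω)| ≤ d} ∩ W ⁻¹' G) ≤ c * μ (W ⁻¹' G) := by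
  have : IsProbabilityMeasure (μ.map B) := Measure.isProbabilityMeasure_map hB.aemeasurable
  have : IsProbabilityMeasure (μ.map W) := Measure.isProbabilityMeasure_map hW.aemeasurable
  let E : Set (ℝ × γ) := {p | |p.1 + f p.2| ≤ d} ∩ Prod.snd ⁻¹' G
  have hE : MeasurableSet E :=
    (measurableSet_le (by fun_prop) measurable_const).inter (measurable_snd hG)
  calc μ ({ω | |B ω + f (W ω)| ≤ d} ∩ W ⁻¹' G)
      = μ.map (fun ω => (B ω, W ω)) E := by
        rw [Measure.map_apply (hB.prodMk hW) hE]; rfl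
    _ = ∫⁻ w, μ.map B ((fun b => (b, w)) ⁻¹' E) ∂μ.map W := by
        rw [hBW.map_prod_eq_prod_map_map hB.aemeasurable hW.aemeasurable,
          Measure.prod_apply_symm hE]
    _ ≤ ∫⁻ w, G.indicator (fun _ => c) w ∂μ.map W := by
        refine lintegral_mono fun w => ?_
        by_cases hw : w ∈ G
        · rw [Set.indicator_of_mem hw]
          refine (measure_mono fun b hb => ?_).trans (hc (-f w))
          simpa [Real.dist_eq] using hb.1
        · rw [Set.indicator_of_notMem hw, nonpos_iff_eq_zero]
          convert measure_empty (μ := μ.map B)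
          ext b
          simp [E, hw]
    _ = c * μ (W ⁻¹' G) := by rw [lintegral_indicator_const hG, Measure.map_apply hW hG]

instance (n : ℕ) : IsProbabilityMeasure (gaussVec n) := by
  unfold gaussVec; infer_instance

lemma iIndepFun_eval_gaussVec (n : ℕ) : iIndepFun (fun i (x : Fin n → ℝ) => x i) (gaussVec n) :=
  iIndepFun_pi (X := fun _ => id) fun _ => aemeasurable_id

/-- A sum of `|U|` coordinates of a standard Gaussian vector has law `N(0, |U|)`. -/
lemma map_sum_gaussVec {n : ℕ} (U : Finset (Fin n)) :
    (gaussVec n).map (fun x => ∑ i ∈ U, x i) = gaussianReal 0 U.card := by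
  induction U using Finset.induction_on with
  | empty => simp
  | insert a U ha ih =>
    have hindep : IndepFun (fun x : Fin n → ℝ => x a) (fun x => ∑ i ∈ U, x i) (gaussVec n) := by
      have h := ((iIndepFun_eval_gaussVec n).indepFun_finsetSum_of_notMem
        (fun i => measurable_pi_apply i) ha).symm
      convert h using 1
      ext x
      simp
    have ha' : (gaussVec n).map (fun x => x a) = gaussianReal 0 1 :=
      (measurePreserving_eval (fun _ : Fin n => gaussianReal 0 1) a).map_eq
    have h := gaussianReal_add_gaussianReal_of_indepFun hindep ha' ih
    simp only [Finset.sum_insert ha, Finset.card_insert_of_notMem ha]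
    rw [zero_add] at h
    rw [Nat.cast_succ, add_comm]
    exact h

lemma measure_abs_sum_gaussVec_le {n : ℕ} (U : Finset (Fin n)) (d : ℝ) :
    gaussVec n {x | |∑ i ∈ U, x i| ≤ d} = gaussianReal 0 U.card (Metric.closedBall 0 d) := by
  rw [← map_sum_gaussVec, Measure.map_apply (by fun_prop) Metric.isClosed_closedBall.measurableSet]
  congr 1
  ext x
  simp

/-- Two coordinate sums over `S` and `T` of a standard Gaussian vector are simultaneously small
with probability bounded through the density of the sum over `S \ T`, which is independent of the
coordinates in `T`. -/
lemma measure_abs_sum_inter_le {n : ℕ} {S T : Finset (Fin n)} (hST : (S \ T).Nonempty)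
    (hT : T.Nonempty) {d : ℝ} (hd : 0 ≤ d) :
    gaussVec n ({x | |∑ i ∈ S, x i| ≤ d} ∩ {x | |∑ i ∈ T, x i| ≤ d}) ≤
      ENNReal.ofReal ((√(2 * Real.pi * (S \ T).card))⁻¹ * (2 * d) *
        ((√(2 * Real.pi * T.card))⁻¹ * (2 * d))) := by
  let φ : (T → ℝ) → ℝ × ℝ := fun t => (∑ i : T, if (i : Fin n) ∈ S then t i else 0, ∑ i : T, t i)
  have hφ : Measurable φ := by
    refine Measurable.prodMk (Finset.measurable_sum _ fun i _ => ?_) (by fun_prop)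
    split_ifs <;> fun_prop
  let W : (Fin n → ℝ) → ℝ × ℝ := fun x => (∑ i ∈ T ∩ S, x i, ∑ i ∈ T, x i)
  have hindep : IndepFun (fun x : Fin n → ℝ => ∑ i ∈ S \ T, x i) W (gaussVec n) := by
    have h := ((iIndepFun_eval_gaussVec n).indepFun_finset (S \ T) T Finset.sdiff_disjoint
      (fun i => measurable_pi_apply i)).comp
      (φ := fun s : (↥(S \ T) → ℝ) => ∑ i, s i) (ψ := φ) (by fun_prop) hφ
    convert h using 1
    · ext x
      exact (Finset.sum_coe_sort (S \ T) x).symm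
    · ext x
      · simp only [W, φ, Function.comp]
        rw [Finset.sum_coe_sort T (fun i => if i ∈ S then x i else 0), Finset.sum_ite_mem]
      · exact (Finset.sum_coe_sort T x).symm
  have hbound := hindep.measure_abs_add_le_inter_le (by fun_prop) (by fun_prop) measurable_fst
    (G := {p | |p.2| ≤ d}) (measurableSet_le (by fun_prop) measurable_const) (d := d)
    (c := ENNReal.ofReal ((√(2 * Real.pi * (S \ T).card))⁻¹ * (2 * d))) fun a => by
      rw [map_sum_gaussVec]
      exact_mod_cast gaussianReal_closedBall_le 0
        (Nat.cast_ne_zero.2 (Finset.card_ne_zero.2 hST)) a d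
  have hTle : gaussVec n (W ⁻¹' {p | |p.2| ≤ d}) ≤
      ENNReal.ofReal ((√(2 * Real.pi * T.card))⁻¹ * (2 * d)) :=
    (measure_abs_sum_gaussVec_le T d).le.trans <| by
      exact_mod_cast gaussianReal_closedBall_le 0
        (Nat.cast_ne_zero.2 (Finset.card_ne_zero.2 hT)) 0 d
  rw [ENNReal.ofReal_mul (by positivity)]
  refine le_trans (le_of_eq ?_) (hbound.trans (mul_le_mul_right hTle _))
  congr 2
  ext x
  rw [Set.mem_ofPred_eq, Set.mem_ofPred_eq, ← Finset.sum_inter_add_sum_sdiff S T, add_comm,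
    Finset.inter_comm]

/-- The bound on the joint failure probability for a single standard Gaussian vector. -/
lemma measure_lt_abs_sum_inter_le {n k : ℕ} (hk : 0 < k) {S T : Finset (Fin n)}
    (hS : S.card = k) (hT : T.card = k) {β : ℝ} (hβ1 : β < 1)
    (hcap : ((S ∩ T).card : ℝ) = β * k) {d : ℝ} (hd : 0 ≤ d) :
    (gaussVec n).real ({x | d < |∑ i ∈ S, x i|} ∩ {x | d < |∑ i ∈ T, x i|}) ≤
      1 - 2 * (√(2 / Real.pi) * (d / √k) - (d / √k) ^ 3 / √(2 * Real.pi)) +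
        (2 / Real.pi) * (d / √k) ^ 2 / (1 - β) := by
  have hkR : (0 : ℝ) < k := Nat.cast_pos.2 hk
  have hsdiff : ((S \ T).card : ℝ) = (1 - β) * k := by
    have h := Finset.card_sdiff_add_card_inter S T
    rw [hS] at h
    have : ((S \ T).card : ℝ) + (S ∩ T).card = k := by exact_mod_cast h
    linarith
  have hST : (S \ T).Nonempty := by
    rw [← Finset.card_pos, ← Nat.cast_pos (α := ℝ), hsdiff]
    exact mul_pos (by linarith) hkR
  have hTne : T.Nonempty := Finset.card_pos.1 (hT ▸ hk)
  have hmeas (U : Finset (Fin n)) : MeasurableSet {x : Fin n → ℝ | |∑ i ∈ U, x i| ≤ d} :=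
    measurableSet_le (by fun_prop) measurable_const
  have hlower (U : Finset (Fin n)) (hU : U.card = k) :
      √(2 / Real.pi) * (d / √k) - (d / √k) ^ 3 / √(2 * Real.pi) ≤
        (gaussVec n).real {x | |∑ i ∈ U, x i| ≤ d} := by
    have h := le_gaussianReal_zero_closedBall (v := k) (Nat.cast_ne_zero.2 hk.ne') hd
    rw [← hU, ← measure_abs_sum_gaussVec_le, hU, ENNReal.ofReal_le_iff_le_toReal (by finiteness)]
      at h
    refine le_trans (le_of_eq ?_) h
    have hsk : √(k : ℝ) ^ 2 = k := Real.sq_sqrt hkR.le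
    have h2 : √(2 : ℝ) ^ 2 = 2 := Real.sq_sqrt (by norm_num)
    rw [NNReal.coe_natCast, Real.sqrt_div (by norm_num), Real.sqrt_mul (by positivity) (k : ℝ),
      Real.sqrt_mul (by norm_num) Real.pi]
    have : 0 < √(k : ℝ) := Real.sqrt_pos.2 hkR
    have : 0 < √Real.pi := Real.sqrt_pos.2 Real.pi_pos
    rw [← hsk]
    field_simp
    rw [Real.sqrt_sq (by positivity), h2]
    ring
  have hupper : (gaussVec n).real ({x | |∑ i ∈ S, x i| ≤ d} ∩ {x | |∑ i ∈ T, x i| ≤ d}) ≤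
      (2 / Real.pi) * (d / √k) ^ 2 / (1 - β) := by
    have h := ENNReal.toReal_le_of_le_ofReal (by positivity) (measure_abs_sum_inter_le hST hTne hd)
    refine h.trans ?_
    have hβ : 0 < 1 - β := by linarith
    have hc : 0 < 2 * Real.pi * ((1 - β) * k) := by positivity
    have hmono : (√(2 * Real.pi * k))⁻¹ ≤ (√(2 * Real.pi * ((1 - β) * k)))⁻¹ := by
      gcongr
      linarith [hcap ▸ Nat.cast_nonneg (α := ℝ) (S ∩ T).card]
    rw [hsdiff, hT]
    calc _ ≤ (√(2 * Real.pi * ((1 - β) * k)))⁻¹ * (2 * d) *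
          ((√(2 * Real.pi * ((1 - β) * k)))⁻¹ * (2 * d)) := by gcongr
      _ = (√(2 * Real.pi * ((1 - β) * k)) ^ 2)⁻¹ * (2 * d) ^ 2 := by ring
      _ = _ := by
        rw [Real.sq_sqrt hc.le, div_pow, Real.sq_sqrt hkR.le]
        field_simp
  have hcompl : {x : Fin n → ℝ | d < |∑ i ∈ S, x i|} ∩ {x | d < |∑ i ∈ T, x i|} =
      ({x | |∑ i ∈ S, x i| ≤ d} ∪ {x | |∑ i ∈ T, x i| ≤ d})ᶜ := by
    ext x
    simp
  have hunion := measureReal_union_add_inter (μ := gaussVec n)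
    (s := {x | |∑ i ∈ S, x i| ≤ d}) (hmeas T)
  rw [hcompl, probReal_compl_eq_one_sub ((hmeas S).union (hmeas T))]
  linarith [hlower S hS, hlower T hT]

/-- for sets `S, T` of size `k` with `|S ∩ T| = βk`, `β ≤ 0.9`, and
`δ = d/√k < 1`, `P[F_S ∩ F_T] ≤ (1 − 2(√(2/π)δ − δ³/√(2π)) + (2/π)δ²/(1−β))^m`. -/
theorem joint_failure_prob_upper_bound (n k m : ℕ) (hk : 0 < k) (hkn : k ≤ n) (hm : 0 < m)
    (S T : Finset (Fin n)) (hS : S.card = k) (hT : T.card = k)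
    (β : ℝ) (hβ0 : 0 ≤ β) (hβ1 : β ≤ 0.9) (hcap : ((S ∩ T).card : ℝ) = β * k)
    (d : ℝ) (hd : 0 < d) (hδ : d / Real.sqrt k < 1) :
    gaussMat m n (FEvent m n d S ∩ FEvent m n d T) ≤
      ENNReal.ofReal
        ((1 - 2 * (Real.sqrt (2 / Real.pi) * (d / Real.sqrt k) -
              (d / Real.sqrt k) ^ 3 / Real.sqrt (2 * Real.pi)) +
            (2 / Real.pi) * (d / Real.sqrt k) ^ 2 / (1 - β)) ^ m) := by
  have hbase := measure_lt_abs_sum_inter_le hk hS hT (by linarith) hcap hd.le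
  have hset : FEvent m n d S ∩ FEvent m n d T = Set.univ.pi fun _ : Fin m =>
      {x | d < |∑ i ∈ S, x i|} ∩ {x | d < |∑ i ∈ T, x i|} := by
    ext v
    simp [FEvent, forall_and]
  rw [hset, gaussMat, Measure.pi_pi, Finset.prod_const, Finset.card_univ, Fintype.card_fin,
    ENNReal.ofReal_pow (measureReal_nonneg.trans hbase)]
  exact pow_le_pow_left' (ENNReal.le_ofReal_iff_toReal_le (by finiteness)
    (measureReal_nonneg.trans hbase) |>.2 hbase) m
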